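/- arXiv:math/0009205 — 2 statements merged into one kernel-verified Lean document; each statement's English description precedes it below -/
import Mathlib

section
/- (Step 4.) For every (a,b,c) ∈ O₃ and every permutation σ of three letters, (a,b,c) ⇝¹⁰⁰ (σ(a),σ(b),σ(c)); that is, (a,b,c) is related by ⇝¹⁰⁰ to each of the six triples (a,b,c), (b,c,a), (c,a,b), (a,c,b), (b,a,c), (c,b,a). -/
open Topology

/-- The set of triples of pairwise distinct points of `W`. -/
def O3 (W : Type*) : Set (W × W × W) :=
  {t | t.1 ≠ t.2.1 ∧ t.1 ≠ t.2.2 ∧ t.2.1 ≠ t.2.2}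

/-- The set of quadruples `(a,b,c,d)` with `(a,b,c) ∈ O₃` and `d ∈ D(a,b,c)`. -/
def O4 {W : Type*} (D : W → W → W → Set W) : Set (W × W × W × W) :=
  {q | (q.1, q.2.1, q.2.2.1) ∈ O3 W ∧ q.2.2.2 ∈ D q.1 q.2.1 q.2.2.1}

/-- The initial triple `(q¹, q², q³)` of a quadruple. -/
def tri1 {W : Type*} (q : W × W × W × W) : W × W × W := (q.1, q.2.1, q.2.2.1)

/-- The final triple `(q³, q², q⁴)` of a quadruple. -/
def tri2 {W : Type*} (q : W × W × W × W) : W × W × W := (q.2.2.1, q.2.1, q.2.2.2)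

/-- The triple `(q², q⁴, q³)` of a quadruple, one of the two admissible transitions. -/
def stepA {W : Type*} (q : W × W × W × W) : W × W × W := (q.2.1, q.2.2.2, q.2.2.1)

/-- The triple `(q³, q², q⁴)` of a quadruple, the other admissible transition. -/
def stepB {W : Type*} (q : W × W × W × W) : W × W × W := (q.2.2.1, q.2.1, q.2.2.2)

/-- `Leads Q p t t'` (written `t ⇝ᵖ t'` in the paper): there is a chain `q₁, …, q_j`
of at most `p` quadruples of `Q` with `(q₁¹,q₁²,q₁³) = t`, `(q_j³,q_j²,q_j⁴) = t'`, and
consecutive quadruples related by one of the two admissible transitions. -/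
def Leads {W : Type*} (Q : Set (W × W × W × W)) (p : ℕ) (t t' : W × W × W) : Prop :=
  ∃ j : ℕ, 1 ≤ j ∧ j ≤ p ∧ ∃ q : ℕ → W × W × W × W,
    (∀ n < j, q n ∈ Q) ∧ tri1 (q 0) = t ∧ tri2 (q (j - 1)) = t' ∧
    ∀ n, n + 1 < j →
      tri1 (q (n + 1)) = stepA (q n) ∨ tri1 (q (n + 1)) = stepB (q n)

section Leads

variable {W : Type*} {Q : Set (W × W × W × W)} {p r : ℕ} {s t u : W × W × W}

theorem Leads.mono (h : Leads Q p s t) (hpr : p ≤ r) : Leads Q r s t := by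
  obtain ⟨j, h1, hj, hq⟩ := h
  exact ⟨j, h1, hj.trans hpr, hq⟩

theorem Leads.single {a b c d : W} (h : (a, b, c, d) ∈ Q) :
    Leads Q 1 (a, b, c) (c, b, d) :=
  ⟨1, le_rfl, le_rfl, fun _ => (a, b, c, d), fun _ _ => h, rfl, rfl, fun n hn => by omega⟩

theorem Leads.cons {q : W × W × W × W} (hq : q ∈ Q) (hs : s = stepA q ∨ s = stepB q)
    (h : Leads Q p s t) : Leads Q (p + 1) (tri1 q) t := by
  obtain ⟨j, h1, hj, f, hf, h0, hlast, hstep⟩ := h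
  refine ⟨j + 1, by omega, by omega, fun n => n.casesOn q f, ?_, rfl, ?_, ?_⟩
  · rintro (_ | n) hn
    · exact hq
    · exact hf n (by omega)
  · obtain ⟨i, rfl⟩ : ∃ i, j = i + 1 := ⟨j - 1, by omega⟩
    exact hlast
  · rintro (_ | n) hn
    · rw [← h0] at hs
      exact hs
    · exact hstep n (by omega)

theorem Leads.consA {a b c d : W} (hq : (a, b, c, d) ∈ Q) (h : Leads Q p (b, d, c) t) :
    Leads Q (p + 1) (a, b, c) t :=
  Leads.cons hq (Or.inl rfl) h

theorem Leads.consB {a b c d : W} (hq : (a, b, c, d) ∈ Q) (h : Leads Q p (c, b, d) t) :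
    Leads Q (p + 1) (a, b, c) t :=
  Leads.cons hq (Or.inr rfl) h

theorem Leads.trans (h : Leads Q p s t) (h' : Leads Q r t u) : Leads Q (p + r) s u := by
  obtain ⟨j, h1, hj, f, hf, rfl, rfl, hstep⟩ := h
  suffices H : ∀ (i : ℕ) (f : ℕ → W × W × W × W), (∀ n < i + 1, f n ∈ Q) →
      (∀ n, n + 1 < i + 1 → tri1 (f (n + 1)) = stepA (f n) ∨ tri1 (f (n + 1)) = stepB (f n)) →
      Leads Q r (tri2 (f i)) u → Leads Q (i + 1 + r) (tri1 (f 0)) u by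
    obtain ⟨i, rfl⟩ : ∃ i, j = i + 1 := ⟨j - 1, by omega⟩
    exact (H i f hf hstep h').mono (by omega)
  intro i
  induction i with
  | zero =>
    intro f hf _ h
    exact (Leads.cons (hf 0 (by omega)) (Or.inr rfl) h).mono (by omega)
  | succ i ih =>
    intro f hf hstep h
    exact (Leads.cons (hf 0 (by omega)) (hstep 0 (by omega))
      (ih (fun n => f (n + 1)) (fun n hn => hf (n + 1) (by omega))
        (fun n hn => hstep (n + 1) (by omega)) h)).mono (by omega)

end Leads

/-- Every triple leads to its cyclic rotation. The points `a`, `b`, `c` are moved away in this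
order, by smaller and smaller amounts, and then brought back in the opposite order. -/
theorem leads_rotate {W : Type*} [TopologicalSpace W] {D : W → W → W → Set W}
    (h3 : ∀ a b c : W, (a, b, c) ∈ O3 W → a ∈ closure (D a b c))
    (h4open : IsOpen (O4 D))
    (h4dist : ∀ a b c d : W, (a, b, c, d) ∈ O4 D →
      a ≠ b ∧ a ≠ c ∧ a ≠ d ∧ b ≠ c ∧ b ≠ d ∧ c ≠ d)
    (h4rev : ∀ a b c d : W, (a, b, c, d) ∈ O4 D → (d, c, b, a) ∈ O4 D)
    {a b c : W} (habc : (a, b, c) ∈ O3 W) :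
    Leads (O4 D) 8 (a, b, c) (b, c, a) := by
  have near : ∀ {x y z : W} {P : W → Prop}, (x, y, z) ∈ O3 W → (∀ᶠ w in 𝓝 x, P w) →
      ∃ w, (x, y, z, w) ∈ O4 D ∧ P w := fun {x y z P} h hP => by
    obtain ⟨w, hw, hPw⟩ := ((mem_closure_iff_frequently.1 (h3 x y z h)).and_eventually hP).exists
    exact ⟨w, ⟨h, hw⟩, hPw⟩
  have ev : ∀ {f : W → W × W × W × W} {x : W}, f x ∈ O4 D → Continuous f →
      ∀ᶠ w in 𝓝 x, f w ∈ O4 D := fun hx hf => (h4open.preimage hf).mem_nhds hx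
  obtain ⟨a₁, ha₁, -⟩ := near habc (Filter.Eventually.of_forall fun _ => trivial)
  obtain ⟨-, -, -, hbc, hba₁, hca₁⟩ := h4dist _ _ _ _ ha₁
  obtain ⟨b₁, hb₁, -⟩ := near (x := b) (y := a₁) (z := c) ⟨hba₁, hbc, hca₁.symm⟩
    (Filter.Eventually.of_forall fun _ => trivial)
  obtain ⟨-, -, -, -, ha₁b₁, hcb₁⟩ := h4dist _ _ _ _ hb₁
  obtain ⟨c₁, hc₁, -⟩ := near (x := c) (y := a₁) (z := b₁) ⟨hca₁, hcb₁, ha₁b₁⟩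
    (Filter.Eventually.of_forall fun _ => trivial)
  obtain ⟨-, -, -, -, ha₁c₁, hb₁c₁⟩ := h4dist _ _ _ _ hc₁
  obtain ⟨b₂, hb₂, hbb₂, hcb₂⟩ := near (x := b₁) (y := a₁) (z := c₁)
    ⟨ha₁b₁.symm, hb₁c₁, ha₁c₁⟩
    ((ev (f := fun w => (b, a₁, c, w)) hb₁ (by fun_prop)).and
      (ev (f := fun w => (c, a₁, w, c₁)) hc₁ (by fun_prop)))
  obtain ⟨-, -, -, -, ha₁b₂, hc₁b₂⟩ := h4dist _ _ _ _ hb₂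
  obtain ⟨a₂, ha₂, haa₂, hba₂, hca₂⟩ := near (x := a₁) (y := b₂) (z := c₁)
    ⟨ha₁b₂, ha₁c₁, hc₁b₂.symm⟩
    ((ev (f := fun w => (a, b, c, w)) ha₁ (by fun_prop)).and
      ((ev (f := fun w => (b, w, c, b₂)) hbb₂ (by fun_prop)).and
        (ev (f := fun w => (c, w, b₂, c₁)) hcb₂ (by fun_prop))))
  exact .consA ha₁ <| .consB hb₁ <| .consB hc₁ <| .consA hb₂ <| .consB ha₂ <|
    .consA (h4rev _ _ _ _ hca₂) <| .consB (h4rev _ _ _ _ hba₂) <| .single (h4rev _ _ _ _ haa₂)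

/-- Every triple leads to its reversal. -/
theorem leads_reverse {W : Type*} [TopologicalSpace W] {D : W → W → W → Set W}
    (h3 : ∀ a b c : W, (a, b, c) ∈ O3 W → a ∈ closure (D a b c))
    (h4open : IsOpen (O4 D))
    (h4dist : ∀ a b c d : W, (a, b, c, d) ∈ O4 D →
      a ≠ b ∧ a ≠ c ∧ a ≠ d ∧ b ≠ c ∧ b ≠ d ∧ c ≠ d)
    (h4rev : ∀ a b c d : W, (a, b, c, d) ∈ O4 D → (d, c, b, a) ∈ O4 D)
    {a b c : W} (habc : (a, b, c) ∈ O3 W) :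
    Leads (O4 D) 35 (a, b, c) (c, b, a) := by
  obtain ⟨hab, hac, hbc⟩ := habc
  have rot : ∀ {x y z : W}, x ≠ y → x ≠ z → y ≠ z → Leads (O4 D) 16 (x, y, z) (z, x, y) :=
    fun hxy hxz hyz =>
      (leads_rotate h3 h4open h4dist h4rev ⟨hxy, hxz, hyz⟩).trans
        (leads_rotate h3 h4open h4dist h4rev ⟨hyz, hxy.symm, hxz.symm⟩)
  obtain ⟨x, hx⟩ := closure_nonempty_iff.1 ⟨a, h3 a c b ⟨hac, hab, hbc.symm⟩⟩
  have hxa : (x, b, c, a) ∈ O4 D := h4rev _ _ _ _ ⟨⟨hac, hab, hbc.symm⟩, hx⟩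
  have hopen : IsOpen {w | (x, b, c, w) ∈ O4 D} :=
    h4open.preimage (f := fun w => (x, b, c, w)) (by fun_prop)
  obtain ⟨y, hxy, hy⟩ := mem_closure_iff.1 (h3 a b c ⟨hab, hac, hbc⟩) _ hopen hxa
  have hay : (a, b, c, y) ∈ O4 D := ⟨⟨hab, hac, hbc⟩, hy⟩
  obtain ⟨-, -, -, -, hby, hcy⟩ := h4dist _ _ _ _ hay
  obtain ⟨hxb, hxc, -⟩ := h4dist _ _ _ _ hxa
  exact (Leads.single hay).trans <| (rot hbc.symm hcy hby).trans <|
    (Leads.single (h4rev _ _ _ _ hxy)).trans <| (rot hbc hxb.symm hxc.symm).trans <|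
    Leads.single hxa

/-- Step 4: for every `(a,b,c) ∈ O₃` and every permutation `σ` of three letters,
`(a,b,c) ⇝¹⁰⁰ (σ(a),σ(b),σ(c))`. -/
theorem leads_step4 {W : Type*} [MetricSpace W] (D : W → W → W → Set W)
    (h2 : ∀ a b c : W, (a, b, c) ∈ O3 W → Dense (D a b c ∪ D a c b))
    (h3 : ∀ a b c : W, (a, b, c) ∈ O3 W → a ∈ closure (D a b c))
    (h4open : IsOpen (O4 D))
    (h4dist : ∀ a b c d : W, (a, b, c, d) ∈ O4 D →
      a ≠ b ∧ a ≠ c ∧ a ≠ d ∧ b ≠ c ∧ b ≠ d ∧ c ≠ d)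
    (h4rev : ∀ a b c d : W, (a, b, c, d) ∈ O4 D → (d, c, b, a) ∈ O4 D)
    (a b c : W) (habc : (a, b, c) ∈ O3 W) (σ : Equiv.Perm (Fin 3)) :
    Leads (O4 D) 100 (a, b, c) (![a, b, c] (σ 0), ![a, b, c] (σ 1), ![a, b, c] (σ 2)) := by

  have rot : ∀ {x y z : W}, (x, y, z) ∈ O3 W → Leads (O4 D) 8 (x, y, z) (y, z, x) :=
    leads_rotate h3 h4open h4dist h4rev
  obtain ⟨hab, hac, hbc⟩ := id habc
  have r1 := rot habc
  have r2 := r1.trans (rot ⟨hbc, hab.symm, hac.symm⟩)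
  have r3 := r2.trans (rot ⟨hac.symm, hbc.symm, hab⟩)
  have s0 := leads_reverse h3 h4open h4dist h4rev habc
  have s1 := s0.trans (rot ⟨hbc.symm, hac.symm, hab.symm⟩)
  have s2 := s1.trans (rot ⟨hab.symm, hbc, hac⟩)
  have h01 : σ 0 ≠ σ 1 := σ.injective.ne (by decide)
  have h02 : σ 0 ≠ σ 2 := σ.injective.ne (by decide)
  have h12 : σ 1 ≠ σ 2 := σ.injective.ne (by decide)
  generalize σ 0 = i at *
  generalize σ 1 = j at *
  generalize σ 2 = k at *
  fin_cases i <;> fin_cases j <;> fin_cases k <;>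
    first
    | exact absurd rfl h01
    | exact absurd rfl h02
    | exact absurd rfl h12
    | exact r1.mono (by norm_num)
    | exact r2.mono (by norm_num)
    | exact r3.mono (by norm_num)
    | exact s0.mono (by norm_num)
    | exact s1.mono (by norm_num)
    | exact s2.mono (by norm_num)
end

section
/- (Γ-invariance of the measure built from an equivariant family of measures.) In addition to the hypotheses of the basepoint-independence statement, let G be a group acting on the set M and acting measurably on ∂, and assume: μ_{g·x} is the pushforward of μ_x under the action of g on ∂, c(g·a, g·x, g·y) = c(a, x, y), and β(g·a, g·b, g·e) = g·β(a, b, e), for all g ∈ G, a, b, e ∈ ∂ and x, y ∈ M. Then the measure μ̄³ := (μ_x ⊗ μ_x ⊗ μ_x).withDensity((a,b,e) ↦ exp(c(a, x, β(a,b,e)) + c(b, x, β(a,b,e)) + c(e, x, β(a,b,e)))) (which is independent of the choice of x) is G-invariant: for every g ∈ G, the pushforward of μ̄³ under the diagonal action (a,b,e) ↦ (g·a, g·b, g·e) equals μ̄³. -/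
open MeasureTheory

/-- The pushforward of a measure whose density is a pullback along the map. -/
theorem map_withDensity_comp {α β : Type*} [MeasurableSpace α] [MeasurableSpace β]
    (ν : Measure α) {f : α → β} {ρ : β → ENNReal} (hf : Measurable f) (hρ : Measurable ρ) :
    (ν.withDensity (fun a => ρ (f a))).map f = (ν.map f).withDensity ρ := by
  ext s hs
  rw [Measure.map_apply hf hs, withDensity_apply _ (hf hs), withDensity_apply _ hs,
    setLIntegral_map hs hρ hf]

theorem prod_prod_withDensity {α : Type*} [MeasurableSpace α] (ν : Measure α) [SFinite ν]
    {f : α → ENNReal} (hf : Measurable f) :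
    (ν.withDensity f).prod ((ν.withDensity f).prod (ν.withDensity f)) =
      (ν.prod (ν.prod ν)).withDensity fun p => f p.1 * (f p.2.1 * f p.2.2) := by
  rw [prod_withDensity hf hf, prod_withDensity hf (by fun_prop)]

theorem map_prod_prod {α β : Type*} [MeasurableSpace α] [MeasurableSpace β] (ν : Measure α)
    [SFinite ν] {f : α → β} (hf : Measurable f) :
    (ν.prod (ν.prod ν)).map (fun p => (f p.1, f p.2.1, f p.2.2)) =
      (ν.map f).prod ((ν.map f).prod (ν.map f)) := by
  rw [Measure.map_prod_map _ _ hf hf, Measure.map_prod_map _ _ hf (hf.prodMap hf)]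
  rfl

/-- The barycentric measure on triples does not depend on the basepoint. -/
theorem barycentric_measure_basepoint_independent {B M : Type*} [MeasurableSpace B]
    (μ : M → Measure B) (hσ : ∀ x : M, SigmaFinite (μ x))
    (c : B → M → M → ℝ) (β : B → B → B → M)
    (hc_meas : ∀ x y : M, Measurable fun a : B => c a x y)
    (hρ_meas : ∀ x : M, Measurable fun p : B × B × B =>
      c p.1 x (β p.1 p.2.1 p.2.2) + c p.2.1 x (β p.1 p.2.1 p.2.2)
        + c p.2.2 x (β p.1 p.2.1 p.2.2))
    (hcocycle : ∀ (a : B) (x y z : M), c a x z = c a x y + c a y z)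
    (hdens : ∀ x y : M,
      μ x = (μ y).withDensity fun a => ENNReal.ofReal (Real.exp (-(c a x y))))
    (x y : M) :
    (((μ x).prod ((μ x).prod (μ x))).withDensity fun p : B × B × B =>
        ENNReal.ofReal (Real.exp (c p.1 x (β p.1 p.2.1 p.2.2)
          + c p.2.1 x (β p.1 p.2.1 p.2.2) + c p.2.2 x (β p.1 p.2.1 p.2.2))))
    = (((μ y).prod ((μ y).prod (μ y))).withDensity fun p : B × B × B =>
        ENNReal.ofReal (Real.exp (c p.1 y (β p.1 p.2.1 p.2.2)
          + c p.2.1 y (β p.1 p.2.1 p.2.2) + c p.2.2 y (β p.1 p.2.1 p.2.2)))) := by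
  have hf : Measurable fun a => ENNReal.ofReal (Real.exp (-(c a x y))) :=
    (hc_meas x y).neg.exp.ennreal_ofReal
  rw [hdens x y, prod_prod_withDensity _ hf,
    ← withDensity_mul _ (by fun_prop) (hρ_meas x).exp.ennreal_ofReal]
  congr 1
  ext p
  simp only [Pi.mul_apply]
  rw [← ENNReal.ofReal_mul (by positivity), ← ENNReal.ofReal_mul (by positivity),
    ← ENNReal.ofReal_mul (by positivity), ← Real.exp_add, ← Real.exp_add, ← Real.exp_add,
    hcocycle p.1 x y (β _ _ _),
    hcocycle p.2.1 x y (β _ _ _), hcocycle p.2.2 x y (β _ _ _)]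
  congr 2
  ring

/-- `Γ`-invariance: the measure `μ̄³` built from an equivariant family of measures,
an invariant cocycle `c` and an equivariant barycenter map `β` is invariant under the
diagonal action of the group `G` on triples of boundary points. -/
theorem barycentric_measure_invariant {B M G : Type*}
    [MeasurableSpace B] [Nonempty M]
    [Group G] [MulAction G M] [MulAction G B]
    (hact_meas : ∀ g : G, Measurable fun a : B => g • a)
    (μ : M → Measure B) (hσ : ∀ x : M, SigmaFinite (μ x))
    (c : B → M → M → ℝ) (β : B → B → B → M)
    (hc_meas : ∀ x y : M, Measurable fun a : B => c a x y)
    (hρ_meas : ∀ x : M, Measurable fun p : B × B × B =>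
      c p.1 x (β p.1 p.2.1 p.2.2) + c p.2.1 x (β p.1 p.2.1 p.2.2)
        + c p.2.2 x (β p.1 p.2.1 p.2.2))
    (hcocycle : ∀ (a : B) (x y z : M), c a x z = c a x y + c a y z)
    (hdens : ∀ x y : M,
      μ x = (μ y).withDensity fun a => ENNReal.ofReal (Real.exp (-(c a x y))))
    (hμequiv : ∀ (g : G) (x : M), μ (g • x) = (μ x).map fun a : B => g • a)
    (hcequiv : ∀ (g : G) (a : B) (x y : M), c (g • a) (g • x) (g • y) = c a x y)
    (hβequiv : ∀ (g : G) (a b e : B), β (g • a) (g • b) (g • e) = g • β a b e)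
    (x : M) (g : G) :
    Measure.map (fun p : B × B × B => (g • p.1, g • p.2.1, g • p.2.2))
      (((μ x).prod ((μ x).prod (μ x))).withDensity fun p : B × B × B =>
        ENNReal.ofReal (Real.exp (c p.1 x (β p.1 p.2.1 p.2.2)
          + c p.2.1 x (β p.1 p.2.1 p.2.2) + c p.2.2 x (β p.1 p.2.1 p.2.2))))
    = (((μ x).prod ((μ x).prod (μ x))).withDensity fun p : B × B × B =>
        ENNReal.ofReal (Real.exp (c p.1 x (β p.1 p.2.1 p.2.2)
          + c p.2.1 x (β p.1 p.2.1 p.2.2) + c p.2.2 x (β p.1 p.2.1 p.2.2)))) := by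
  have hdiag : Measurable fun p : B × B × B => (g • p.1, g • p.2.1, g • p.2.2) :=
    (hact_meas g).prodMap ((hact_meas g).prodMap (hact_meas g))
  have h := map_withDensity_comp ((μ x).prod ((μ x).prod (μ x))) hdiag
    (hρ_meas (g • x)).exp.ennreal_ofReal
  simp only [hβequiv, hcequiv] at h
  rw [h, map_prod_prod _ (hact_meas g), ← hμequiv]
  exact barycentric_measure_basepoint_independent μ hσ c β hc_meas hρ_meas hcocycle hdens _ _
end
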